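/- arXiv:2604.20360 — 5 statements merged into one kernel-verified Lean document; each statement's English description precedes it below -/
import Mathlib

section
/- Let U be a real Hilbert space, D : U → U q-contractive with q ∈ (0,1), and u† ∈ U a fixed point of D (i.e., D(u†) = u†). Then for every h ∈ (0,1) and every u ∈ U, ⟨u† − u, u − D_h(u)⟩ ≤ −(c_q/h)‖u − D_h(u)‖² ≤ −c_q‖u − D_h(u)‖², where c_q = (1−q)/(1+q)². -/
open scoped RealInnerProductSpace

/-- If `‖d‖ ≤ q ‖e‖` with `q ∈ [0, 1]`, then `⟪e, e - d⟫` controls `‖e - d‖ ^ 2`. -/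
theorem mul_norm_sub_sq_le_inner_sub {U : Type*} [NormedAddCommGroup U] [InnerProductSpace ℝ U]
    {q : ℝ} (hq0 : 0 ≤ q) (hq1 : q ≤ 1) {e d : U} (hd : ‖d‖ ≤ q * ‖e‖) :
    (1 - q) / (1 + q) ^ 2 * ‖e - d‖ ^ 2 ≤ ⟪e, e - d⟫ := by
  have norm_le : ‖e - d‖ ≤ (1 + q) * ‖e‖ := by linarith [norm_sub_le e d]
  have inner_le : ⟪e, d⟫ ≤ q * ‖e‖ ^ 2 := by
    nlinarith [real_inner_le_norm e d, mul_le_mul_of_nonneg_left hd (norm_nonneg e)]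
  calc (1 - q) / (1 + q) ^ 2 * ‖e - d‖ ^ 2
      ≤ (1 - q) / (1 + q) ^ 2 * ((1 + q) * ‖e‖) ^ 2 := by
        have : 0 ≤ 1 - q := by linarith
        gcongr
    _ = (1 - q) * ‖e‖ ^ 2 := by field_simp
    _ ≤ ⟪e, e - d⟫ := by
        rw [inner_sub_right, real_inner_self_eq_norm_sq]
        linarith

/-- for a `q`-contractive denoiser with fixed point `u†`,
`⟨u† − u, u − D_h(u)⟩ ≤ −(c_q/h)‖u − D_h(u)‖² ≤ −c_q‖u − D_h(u)‖²`,
where `c_q = (1−q)/(1+q)²`. -/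
theorem averaged_denoiser_key_inequality
    {U : Type*} [NormedAddCommGroup U] [InnerProductSpace ℝ U] [CompleteSpace U]
    (D : U → U) (q : ℝ) (hq0 : 0 < q) (hq1 : q < 1)
    (hD : ∀ u w : U, ‖D u - D w‖ ≤ q * ‖u - w‖)
    (udag : U) (hfix : D udag = udag)
    (h : ℝ) (hh0 : 0 < h) (hh1 : h < 1) (u : U) :
    ⟪udag - u, u - (h • D u + (1 - h) • u)⟫
        ≤ -((1 - q) / (1 + q) ^ 2 / h) * ‖u - (h • D u + (1 - h) • u)‖ ^ 2
    ∧ -((1 - q) / (1 + q) ^ 2 / h) * ‖u - (h • D u + (1 - h) • u)‖ ^ 2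
        ≤ -((1 - q) / (1 + q) ^ 2) * ‖u - (h • D u + (1 - h) • u)‖ ^ 2 := by
  have hc : 0 ≤ (1 - q) / (1 + q) ^ 2 := div_nonneg (by linarith) (sq_nonneg _)
  constructor
  · have hd : ‖D u - udag‖ ≤ q * ‖u - udag‖ := by simpa [hfix] using hD u udag
    have key := mul_norm_sub_sq_le_inner_sub hq0.le hq1.le hd
    rw [sub_sub_sub_cancel_right] at key
    have residual : u - (h • D u + (1 - h) • u) = h • (u - D u) := by module
    rw [residual, ← neg_sub u udag, inner_neg_left, real_inner_smul_right, norm_smul,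
      Real.norm_of_nonneg hh0.le, neg_mul, neg_le_neg_iff]
    calc (1 - q) / (1 + q) ^ 2 / h * (h * ‖u - D u‖) ^ 2
        = h * ((1 - q) / (1 + q) ^ 2 * ‖u - D u‖ ^ 2) := by field_simp
      _ ≤ h * ⟪u - udag, u - D u⟫ := by gcongr
  · exact mul_le_mul_of_nonneg_right (neg_le_neg (le_div_self hc hh0 hh1.le)) (sq_nonneg _)
end

section
/- Assume D : U → U is q-contractive with q ∈ (0,1), with D(u†) = u†, and let the DDIR iterates u_k^δ be defined with noisy data v^δ, ‖v^δ − v‖ ≤ δ > 0, where v = G(u†) and u† ∈ B(ρ, u0). Let τ > 1, and suppose C := γ − ν0(ν1 − c_q) − γ1(γ0 + ζ + (1 + ζ)/τ) > 0 and c_q ≤ ν1. Then the discrepancy principle terminates after finitely many steps: there exists a finite index k_dp ∈ ℕ such that ‖G(u_{k_dp}^δ) − v^δ‖ ≤ τδ < ‖G(u_k^δ) − v^δ‖ for all 0 ≤ k < k_dp; moreover, if ‖G(u_k^δ) − v^δ‖ > τδ for k = 0, 1, …, n, then (n+1)τ²δ² < ρ²/(2C). -/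
open scoped RealInnerProductSpace Classical

/-- A step size `min (a / ‖x‖²) c` never lets `‖x‖²` contribute more than `a`. -/
theorem min_div_sq_norm_mul_sq_norm_le {E : Type*} [NormedAddCommGroup E] {x : E} (hx : x ≠ 0)
    (a c : ℝ) : min (a / ‖x‖ ^ 2) c * ‖x‖ ^ 2 ≤ a := by
  have hx2 : 0 < ‖x‖ ^ 2 := by positivity
  calc min (a / ‖x‖ ^ 2) c * ‖x‖ ^ 2 ≤ a / ‖x‖ ^ 2 * ‖x‖ ^ 2 := by gcongr; exact min_le_left _ _
    _ = a := by field_simp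

/-- The residual of an averaged contraction is cocoercive with respect to a fixed point. -/
theorem averaged_contraction_residual_cocoercive {U : Type*} [NormedAddCommGroup U]
    [InnerProductSpace ℝ U] {D : U → U} {q h : ℝ} (hq0 : 0 < q) (hq1 : q < 1)
    (hD : ∀ x y : U, ‖D x - D y‖ ≤ q * ‖x - y‖) {p : U} (hfix : D p = p)
    (hh : h ∈ Set.Ioo (0 : ℝ) 1) (x : U) :
    (1 - q) / (1 + q) ^ 2 * ‖x - (h • D x + (1 - h) • x)‖ ^ 2
      ≤ ⟪x - p, x - (h • D x + (1 - h) • x)⟫ := by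
  obtain ⟨hh0, hh1⟩ := hh
  have hDx : ‖D x - p‖ ≤ q * ‖x - p‖ := by simpa [hfix] using hD x p
  have hres : x - (h • D x + (1 - h) • x) = h • ((x - p) - (D x - p)) := by module
  have hnorm : ‖(x - p) - (D x - p)‖ ≤ (1 + q) * ‖x - p‖ := by
    linarith [norm_sub_le (x - p) (D x - p)]
  have hinner : ⟪x - p, D x - p⟫ ≤ q * ‖x - p‖ ^ 2 := by
    nlinarith [real_inner_le_norm (x - p) (D x - p), norm_nonneg (x - p)]
  rw [hres, norm_smul, real_inner_smul_right, inner_sub_right, real_inner_self_eq_norm_sq,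
    Real.norm_of_nonneg hh0.le, mul_pow]
  have hsq : ‖(x - p) - (D x - p)‖ ^ 2 ≤ (1 + q) ^ 2 * ‖x - p‖ ^ 2 := by
    rw [← mul_pow]
    gcongr
  have hcq : 0 ≤ (1 - q) / (1 + q) ^ 2 := div_nonneg (by linarith) (by positivity)
  calc (1 - q) / (1 + q) ^ 2 * (h ^ 2 * ‖(x - p) - (D x - p)‖ ^ 2)
      ≤ (1 - q) / (1 + q) ^ 2 * (h * ((1 + q) ^ 2 * ‖x - p‖ ^ 2)) := by
        gcongr
        nlinarith
    _ = h * ((1 - q) * ‖x - p‖ ^ 2) := by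
        have : (1 + q) ≠ 0 := by linarith
        field_simp
    _ ≤ h * (‖x - p‖ ^ 2 - ⟪x - p, D x - p⟫) := by
        gcongr
        linarith

/-- Under the tangential cone condition and above the discrepancy level, the adjoint-gradient
direction has a controlled angle with the error. -/
theorem inner_sub_adjoint_residual_ge {U V : Type*}
    [NormedAddCommGroup U] [InnerProductSpace ℝ U] [CompleteSpace U]
    [NormedAddCommGroup V] [InnerProductSpace ℝ V] [CompleteSpace V]
    {G : U → V} {A : U →L[ℝ] V} {x p : U} {ζ δ τ : ℝ} {y : V} (hζ : 0 ≤ ζ) (hτ : 0 < τ)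
    (hcone : ‖G p - G x - A (p - x)‖ ≤ ζ * ‖G p - G x‖) (hy : ‖y - G p‖ ≤ δ)
    (hdisc : τ * δ ≤ ‖G x - y‖) :
    (1 - ζ - (1 + ζ) / τ) * ‖G x - y‖ ^ 2
      ≤ ⟪x - p, ContinuousLinearMap.adjoint A (G x - y)⟫ := by
  rw [ContinuousLinearMap.adjoint_inner_right]
  set r := G x - y with hr
  have hGp : ‖G p - G x‖ ≤ ‖r‖ + δ := by
    have : G p - G x = -r - (y - G p) := by rw [hr]; abel
    rw [this]
    linarith [norm_sub_le (-r) (y - G p), norm_neg r]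
  have hlin : A (x - p) = r + (y - G p) + (G p - G x - A (p - x)) := by
    rw [hr, map_sub, map_sub]
    abel
  have hδ : δ ≤ ‖r‖ / τ := by
    rw [le_div_iff₀ hτ]
    linarith
  have hdata : -(δ * ‖r‖) ≤ ⟪y - G p, r⟫ := by
    nlinarith [neg_le_of_abs_le (abs_real_inner_le_norm (y - G p) r), norm_nonneg r]
  have hrem : -(ζ * (‖r‖ + δ) * ‖r‖) ≤ ⟪G p - G x - A (p - x), r⟫ := by
    have hle : ‖G p - G x - A (p - x)‖ ≤ ζ * (‖r‖ + δ) := hcone.trans (by gcongr)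
    have := mul_le_mul_of_nonneg_right hle (norm_nonneg r)
    linarith [neg_le_of_abs_le (abs_real_inner_le_norm (G p - G x - A (p - x)) r)]
  have hnoise : (1 + ζ) * (δ * ‖r‖) ≤ (1 + ζ) * (‖r‖ / τ * ‖r‖) := by gcongr
  have heq : (1 - ζ - (1 + ζ) / τ) * ‖r‖ ^ 2
      = ‖r‖ ^ 2 - ζ * ‖r‖ ^ 2 - (1 + ζ) * (‖r‖ / τ * ‖r‖) := by ring
  rw [hlin, inner_add_left, inner_add_left, real_inner_self_eq_norm_sq, heq]
  linarith

/-- Error decrease of a damped gradient step with two directions `g` and `d`. -/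
theorem sq_norm_sub_smul_sub_smul_le {U : Type*} [NormedAddCommGroup U] [InnerProductSpace ℝ U]
    {e g d : U} {m l R γ γ0 γ1 ν0 ν1 c b : ℝ} (hγ : 0 < γ) (hγ0 : 0 < γ0) (hb : 0 ≤ b)
    (hcν : c ≤ ν1) (hγm : γ ≤ m) (hmγ : m ≤ γ1) (hl : 0 ≤ l) (hlν : l ≤ ν1)
    (hmg : m * ‖g‖ ^ 2 ≤ γ0 * R ^ 2) (hld : l * ‖d‖ ^ 2 ≤ ν0 * R ^ 2)
    (hg : (1 - b) * R ^ 2 ≤ ⟪e, g⟫) (hd : c * ‖d‖ ^ 2 ≤ ⟪e, d⟫) :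
    ‖e - m • g - l • d‖ ^ 2
      ≤ ‖e‖ ^ 2 - 2 * (γ - ν0 * (ν1 - c) - γ1 * (γ0 + b)) * R ^ 2 := by
  have hm : 0 ≤ m := hγ.le.trans hγm
  have hexp : ‖e - m • g - l • d‖ ^ 2
      = ‖e‖ ^ 2 - 2 * (m * ⟪e, g⟫) - 2 * (l * ⟪e, d⟫) + ‖m • g + l • d‖ ^ 2 := by
    rw [sub_sub, norm_sub_sq_real, inner_add_right, real_inner_smul_right, real_inner_smul_right]
    ring
  have hsum : ‖m • g + l • d‖ ^ 2 ≤ 2 * (m * (m * ‖g‖ ^ 2)) + 2 * (l * (l * ‖d‖ ^ 2)) := by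
    have hpar := parallelogram_law_with_norm ℝ (m • g) (l • d)
    simp only [norm_smul, Real.norm_of_nonneg hm, Real.norm_of_nonneg hl] at hpar
    nlinarith [sq_nonneg ‖m • g - l • d‖]
  have hgstep : m * (m * ‖g‖ ^ 2) ≤ γ1 * (γ0 * R ^ 2) := by
    calc m * (m * ‖g‖ ^ 2) ≤ m * (γ0 * R ^ 2) := by gcongr
      _ ≤ γ1 * (γ0 * R ^ 2) := by gcongr
  have hgdir : γ * R ^ 2 - γ1 * (b * R ^ 2) ≤ m * ⟪e, g⟫ := by
    calc γ * R ^ 2 - γ1 * (b * R ^ 2) ≤ m * R ^ 2 - m * (b * R ^ 2) := by gcongr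
      _ = m * ((1 - b) * R ^ 2) := by ring
      _ ≤ m * ⟪e, g⟫ := by gcongr
  have hdstep : l * (l * ‖d‖ ^ 2) - l * ⟪e, d⟫ ≤ (ν1 - c) * (ν0 * R ^ 2) := by
    calc l * (l * ‖d‖ ^ 2) - l * ⟪e, d⟫ ≤ ν1 * (l * ‖d‖ ^ 2) - l * (c * ‖d‖ ^ 2) := by gcongr
      _ = (ν1 - c) * (l * ‖d‖ ^ 2) := by ring
      _ ≤ (ν1 - c) * (ν0 * R ^ 2) := by
        have : 0 ≤ ν1 - c := by linarith
        gcongr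
  rw [hexp]
  linarith

/-- finite termination of the discrepancy principle for the DDIR iterates with
noisy data, together with the bound `(n+1)τ²δ² < ρ²/(2C)` on the number of iterations for
which the residual exceeds `τδ`. -/
theorem DDIR_finite_termination
    {U V : Type*}
    [NormedAddCommGroup U] [InnerProductSpace ℝ U] [CompleteSpace U]
    [NormedAddCommGroup V] [InnerProductSpace ℝ V] [CompleteSpace V]
    (u0 : U) (ρ : ℝ) (hρ : 0 < ρ)
    (G : U → V) (G' : U → U →L[ℝ] V)
    (hG' : ∀ w ∈ Metric.closedBall u0 (2 * ρ), HasFDerivAt G (G' w) w)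
    (ζ : ℝ) (hζ0 : 0 ≤ ζ) (hζ1 : ζ < 1)
    (hTCC : ∀ w ∈ Metric.closedBall u0 (2 * ρ), ∀ w' ∈ Metric.closedBall u0 (2 * ρ),
      ‖G w - G w' - G' w' (w - w')‖ ≤ ζ * ‖G w - G w'‖)
    (D : U → U) (q : ℝ) (hq0 : 0 < q) (hq1 : q < 1)
    (hD : ∀ x y : U, ‖D x - D y‖ ≤ q * ‖x - y‖)
    (udag : U) (hfix : D udag = udag) (hudag : udag ∈ Metric.closedBall u0 ρ)
    (v : V) (hv : G udag = v)
    (δ : ℝ) (hδpos : 0 < δ) (vδ : V) (hδ : ‖vδ - v‖ ≤ δ)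
    (γ γ0 γ1 ν0 ν1 τ : ℝ)
    (hγ : 0 < γ) (hγ0 : 0 < γ0) (hγ1 : 0 < γ1) (hν0 : 0 < ν0) (hν1 : 0 < ν1)
    (hτ : 1 < τ)
    (hcq : (1 - q) / (1 + q) ^ 2 ≤ ν1)
    (hC : 0 < γ - ν0 * (ν1 - (1 - q) / (1 + q) ^ 2) - γ1 * (γ0 + ζ + (1 + ζ) / τ))
    (hs : ℕ → ℝ) (hhs : ∀ k, hs k ∈ Set.Ioo (0 : ℝ) 1)
    (u : ℕ → U) (μ lam : ℕ → ℝ)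
    (hu0 : u 0 = u0)
    (hμ : ∀ k, μ k =
      if ContinuousLinearMap.adjoint (G' (u k)) (G (u k) - vδ) = 0 then γ1
      else min (γ0 * ‖G (u k) - vδ‖ ^ 2 /
        ‖ContinuousLinearMap.adjoint (G' (u k)) (G (u k) - vδ)‖ ^ 2) γ1)
    (hμγ : ∀ k, γ ≤ μ k)
    (hlam : ∀ k, lam k =
      if u k = hs k • D (u k) + (1 - hs k) • u k then 0
      else min (ν0 * ‖G (u k) - vδ‖ ^ 2 /
        ‖u k - (hs k • D (u k) + (1 - hs k) • u k)‖ ^ 2) ν1)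
    (hiter : ∀ k, u (k + 1) = u k
      - μ k • (ContinuousLinearMap.adjoint (G' (u k)) (G (u k) - vδ))
      - lam k • (u k - (hs k • D (u k) + (1 - hs k) • u k))) :
    (∃ kdp : ℕ, ‖G (u kdp) - vδ‖ ≤ τ * δ ∧ ∀ k < kdp, τ * δ < ‖G (u k) - vδ‖)
    ∧ (∀ n : ℕ, (∀ k ≤ n, τ * δ < ‖G (u k) - vδ‖) →
        (n + 1 : ℝ) * τ ^ 2 * δ ^ 2
          < ρ ^ 2 / (2 * (γ - ν0 * (ν1 - (1 - q) / (1 + q) ^ 2)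
              - γ1 * (γ0 + ζ + (1 + ζ) / τ)))) := by
  set C := γ - ν0 * (ν1 - (1 - q) / (1 + q) ^ 2) - γ1 * (γ0 + ζ + (1 + ζ) / τ) with hCdef
  have hτ0 : 0 < τ := by linarith
  have hμle : ∀ k, μ k ≤ γ1 := by
    intro k
    rw [hμ k]
    split_ifs
    exacts [le_rfl, min_le_right _ _]
  have hμg : ∀ k, μ k * ‖ContinuousLinearMap.adjoint (G' (u k)) (G (u k) - vδ)‖ ^ 2
      ≤ γ0 * ‖G (u k) - vδ‖ ^ 2 := by
    intro k
    rw [hμ k]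
    split_ifs with h
    · rw [h]
      simp only [norm_zero, ne_eq, OfNat.ofNat_ne_zero, not_false_eq_true, zero_pow, mul_zero]
      positivity
    · exact min_div_sq_norm_mul_sq_norm_le h _ _
  have hlam0 : ∀ k, 0 ≤ lam k := by
    intro k
    rw [hlam k]
    split_ifs
    exacts [le_rfl, le_min (by positivity) hν1.le]
  have hlamle : ∀ k, lam k ≤ ν1 := by
    intro k
    rw [hlam k]
    split_ifs
    exacts [hν1.le, min_le_right _ _]
  have hlamd : ∀ k, lam k * ‖u k - (hs k • D (u k) + (1 - hs k) • u k)‖ ^ 2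
      ≤ ν0 * ‖G (u k) - vδ‖ ^ 2 := by
    intro k
    rw [hlam k]
    split_ifs with h
    · rw [zero_mul]
      positivity
    · exact min_div_sq_norm_mul_sq_norm_le (sub_ne_zero.mpr h) _ _
  have hudag' : ‖u 0 - udag‖ ≤ ρ := by
    rw [hu0, ← dist_eq_norm, dist_comm]
    exact hudag
  have hstep : ∀ k, ‖u k - udag‖ ≤ ρ → τ * δ < ‖G (u k) - vδ‖ →
      ‖u (k + 1) - udag‖ ^ 2 ≤ ‖u k - udag‖ ^ 2 - 2 * C * ‖G (u k) - vδ‖ ^ 2 := by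
    intro k hk hR
    have hmem : u k ∈ Metric.closedBall u0 (2 * ρ) := by
      rw [Metric.mem_closedBall] at hudag ⊢
      rw [← dist_eq_norm] at hk
      linarith [dist_triangle (u k) udag u0]
    have hmemdag : udag ∈ Metric.closedBall u0 (2 * ρ) :=
      Metric.closedBall_subset_closedBall (by linarith) hudag
    have hg := inner_sub_adjoint_residual_ge hζ0 hτ0 (hTCC udag hmemdag (u k) hmem)
      (hv ▸ hδ) hR.le
    have hd := averaged_contraction_residual_cocoercive hq0 hq1 hD hfix (hhs k) (u k)
    have hdec := sq_norm_sub_smul_sub_smul_le (b := ζ + (1 + ζ) / τ) hγ hγ0 (by positivity) hcq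
      (hμγ k) (hμle k) (hlam0 k) (hlamle k) (hμg k) (hlamd k) (by rwa [← sub_sub]) hd
    have herr : u (k + 1) - udag = (u k - udag)
        - μ k • ContinuousLinearMap.adjoint (G' (u k)) (G (u k) - vδ)
        - lam k • (u k - (hs k • D (u k) + (1 - hs k) • u k)) := by
      rw [hiter k]
      abel
    rwa [herr, hCdef, add_assoc γ0]
  have hτδ : 0 < τ * δ := by positivity
  have hsq : ∀ n : ℕ, (∀ k < n, τ * δ < ‖G (u k) - vδ‖) →
      ‖u n - udag‖ ^ 2 + 2 * C * (n * (τ * δ) ^ 2) ≤ ρ ^ 2 := by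
    intro n
    induction n with
    | zero =>
      intro _
      simpa using pow_le_pow_left₀ (norm_nonneg _) hudag' 2
    | succ n ih =>
      intro h
      have ihn := ih fun k hk => h k (hk.trans n.lt_succ_self)
      have hn := h n n.lt_succ_self
      have hball : ‖u n - udag‖ ≤ ρ := by
        have : 0 ≤ 2 * C * (n * (τ * δ) ^ 2) := by positivity
        exact le_of_sq_le_sq (by linarith) hρ.le
      have hres : 2 * C * (τ * δ) ^ 2 ≤ 2 * C * ‖G (u n) - vδ‖ ^ 2 := by gcongr
      push_cast
      linarith [hstep n hball hn]
  have hbound : ∀ n : ℕ, (∀ k ≤ n, τ * δ < ‖G (u k) - vδ‖) →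
      (n + 1 : ℝ) * τ ^ 2 * δ ^ 2 < ρ ^ 2 / (2 * C) := by
    intro n h
    have hn := h n le_rfl
    have hprev := hsq n fun k hk => h k hk.le
    have hball : ‖u n - udag‖ ≤ ρ := by
      have : 0 ≤ 2 * C * (n * (τ * δ) ^ 2) := by positivity
      exact le_of_sq_le_sq (by linarith) hρ.le
    have hres : 2 * C * (τ * δ) ^ 2 < 2 * C * ‖G (u n) - vδ‖ ^ 2 := by gcongr
    rw [lt_div_iff₀ (by positivity)]
    linarith [hstep n hball hn, sq_nonneg ‖u (n + 1) - udag‖]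
  refine ⟨?_, hbound⟩
  have hex : ∃ k, ‖G (u k) - vδ‖ ≤ τ * δ := by
    by_contra! hall
    obtain ⟨n, hn⟩ := exists_nat_gt (ρ ^ 2 / (2 * C) / (τ ^ 2 * δ ^ 2))
    rw [div_lt_iff₀ (by positivity)] at hn
    have : 0 < τ ^ 2 * δ ^ 2 := by positivity
    linarith [hbound n fun k _ => hall k]
  exact ⟨Nat.find hex, Nat.find_spec hex, fun k hk => not_le.mp (Nat.find_min hex hk)⟩
end

section
/- Assume D : U → U is q-contractive with q ∈ (0,1), with D(u†) = u†, where u† ∈ B(ρ, u0) satisfies G(u†) = v, suppose every solution u of G(u) = v is a fixed point of D, and let {u_k} be the exact-data DDIR iterates with u_k ∈ B(2ρ, u0) for all k. If u_{k+1} = u_k for some k ≥ 0, then G(u_k) = v, and consequently u_m = u_k for all m > k. -/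
open scoped Classical

/-- A `q`-Lipschitz map with `q ≤ 1` has monotone residual at each of its fixed points. -/
lemma inner_sub_map_nonneg_of_fixed {U : Type*} [NormedAddCommGroup U] [InnerProductSpace ℝ U]
    {D : U → U} {q : ℝ} (hq : q ≤ 1) (hD : ∀ x y : U, ‖D x - D y‖ ≤ q * ‖x - y‖)
    {p : U} (hp : D p = p) (x : U) : 0 ≤ inner ℝ (x - D x) (x - p) := by
  have hsplit : x - D x = (x - p) - (D x - D p) := by rw [hp]; abel
  have hcs := real_inner_le_norm (D x - D p) (x - p)
  rw [hsplit, inner_sub_left, real_inner_self_eq_norm_sq]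
  nlinarith [mul_le_mul_of_nonneg_right (hD x p) (norm_nonneg (x - p)),
    mul_nonneg (sub_nonneg.2 hq) (sq_nonneg ‖x - p‖)]

/-- If `a` is within relative distance `ζ` of `r`, then `⟪r, a⟫ ≥ (1 - ζ) ‖r‖ ^ 2`. -/
lemma one_sub_mul_norm_sq_le_inner {V : Type*} [NormedAddCommGroup V] [InnerProductSpace ℝ V]
    {ζ : ℝ} {r a : V} (h : ‖r - a‖ ≤ ζ * ‖r‖) : (1 - ζ) * ‖r‖ ^ 2 ≤ inner ℝ r a := by
  have hcs := real_inner_le_norm r (r - a)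
  rw [inner_sub_right, real_inner_self_eq_norm_sq] at hcs
  nlinarith [mul_le_mul_of_nonneg_left h (norm_nonneg r)]

/-- if two consecutive exact-data DDIR iterates coincide, then the residual
vanishes at that iterate and all subsequent iterates stagnate. -/
theorem DDIR_stagnation_implies_solution
    {U V : Type*}
    [NormedAddCommGroup U] [InnerProductSpace ℝ U] [CompleteSpace U]
    [NormedAddCommGroup V] [InnerProductSpace ℝ V] [CompleteSpace V]
    (u0 : U) (ρ : ℝ) (hρ : 0 < ρ)
    (G : U → V) (G' : U → U →L[ℝ] V)
    (hG' : ∀ w ∈ Metric.closedBall u0 (2 * ρ), HasFDerivAt G (G' w) w)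
    (ζ : ℝ) (hζ0 : 0 ≤ ζ) (hζ1 : ζ < 1)
    (hTCC : ∀ w ∈ Metric.closedBall u0 (2 * ρ), ∀ w' ∈ Metric.closedBall u0 (2 * ρ),
      ‖G w - G w' - G' w' (w - w')‖ ≤ ζ * ‖G w - G w'‖)
    (D : U → U) (q : ℝ) (hq0 : 0 < q) (hq1 : q < 1)
    (hD : ∀ x y : U, ‖D x - D y‖ ≤ q * ‖x - y‖)
    (udag : U) (hfix : D udag = udag) (hudag : udag ∈ Metric.closedBall u0 ρ)
    (v : V) (hv : G udag = v)
    (hsol : ∀ w : U, G w = v → D w = w)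
    (γ γ0 γ1 ν0 ν1 : ℝ)
    (hγ : 0 < γ) (hγ0 : 0 < γ0) (hγ1 : 0 < γ1) (hν0 : 0 < ν0) (hν1 : 0 < ν1)
    (hs : ℕ → ℝ) (hhs : ∀ k, hs k ∈ Set.Ioo (0 : ℝ) 1)
    (u : ℕ → U) (μ lam : ℕ → ℝ)
    (hu0 : u 0 = u0)
    (hball : ∀ k, u k ∈ Metric.closedBall u0 (2 * ρ))
    (hμ : ∀ k, μ k =
      if ContinuousLinearMap.adjoint (G' (u k)) (G (u k) - v) = 0 then γ1
      else min (γ0 * ‖G (u k) - v‖ ^ 2 /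
        ‖ContinuousLinearMap.adjoint (G' (u k)) (G (u k) - v)‖ ^ 2) γ1)
    (hμγ : ∀ k, γ ≤ μ k)
    (hlam : ∀ k, lam k =
      if ∃ j ≤ k, D (u j) = u j then 0
      else min (ν0 * ‖G (u k) - v‖ ^ 2 /
        ‖u k - (hs k • D (u k) + (1 - hs k) • u k)‖) ν1)
    (hiter : ∀ k, u (k + 1) = u k
      - μ k • (ContinuousLinearMap.adjoint (G' (u k)) (G (u k) - v))
      - lam k • (u k - (hs k • D (u k) + (1 - hs k) • u k)))
    (k : ℕ) (hstag : u (k + 1) = u k) :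
    G (u k) = v ∧ ∀ m : ℕ, k < m → u m = u k := by
  have havg : ∀ n, u n - (hs n • D (u n) + (1 - hs n) • u n) = hs n • (u n - D (u n)) := by
    intro n
    module
  have hlam_nonneg : 0 ≤ lam k := by
    rw [hlam k]
    split_ifs
    · exact le_rfl
    · exact le_min (by positivity) hν1.le
  have hμ_pos : 0 < μ k := hγ.trans_le (hμγ k)
  have hudag' : udag ∈ Metric.closedBall u0 (2 * ρ) :=
    Metric.closedBall_subset_closedBall (by linarith) hudag
  have hres : (1 - ζ) * ‖G (u k) - v‖ ^ 2 ≤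
      inner ℝ (G (u k) - v) (G' (u k) (u k - udag)) := by
    apply one_sub_mul_norm_sq_le_inner
    have h := hTCC udag hudag' (u k) (hball k)
    have hneg : v - G (u k) - G' (u k) (udag - u k)
        = -(G (u k) - v - G' (u k) (u k - udag)) := by
      rw [← neg_sub (u k) udag, map_neg]
      abel
    rwa [hv, hneg, norm_neg, norm_sub_rev v (G (u k))] at h
  have hsum : μ k • ContinuousLinearMap.adjoint (G' (u k)) (G (u k) - v)
      + lam k • hs k • (u k - D (u k)) = 0 := by
    have h := hiter k
    rw [hstag, havg, sub_sub] at h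
    exact sub_eq_self.1 h.symm
  have hinner : μ k * inner ℝ (G (u k) - v) (G' (u k) (u k - udag))
      + lam k * (hs k * inner ℝ (u k - D (u k)) (u k - udag)) = 0 := by
    have h := congrArg (fun x => inner ℝ x (u k - udag)) hsum
    simpa only [inner_add_left, real_inner_smul_left, inner_zero_left,
      ContinuousLinearMap.adjoint_inner_left] using h
  have hden : 0 ≤ lam k * (hs k * inner ℝ (u k - D (u k)) (u k - udag)) :=
    mul_nonneg hlam_nonneg
      (mul_nonneg (hhs k).1.le (inner_sub_map_nonneg_of_fixed hq1.le hD hfix (u k)))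
  have hsolk : G (u k) = v := by
    by_contra hne
    have hr : 0 < ‖G (u k) - v‖ := norm_pos_iff.2 (sub_ne_zero.2 hne)
    have hlow : 0 < (1 - ζ) * ‖G (u k) - v‖ ^ 2 := mul_pos (sub_pos.2 hζ1) (pow_pos hr 2)
    linarith [mul_pos hμ_pos (hlow.trans_le hres)]
  refine ⟨hsolk, fun m hm => ?_⟩
  induction m, hm using Nat.le_induction with
  | base => exact hstag
  | succ n _ ih => rw [hiter n, havg, ih, hsolk, hsol _ hsolk]; simp
end

section
/- Let G be continuous on B(2ρ, u0) with continuous Fréchet derivative u ↦ G'(u), satisfying the tangential cone condition with constant 0 ≤ ζ < 1, and let u, u† ∈ B(2ρ, u0) with G(u†) = v. For w ∈ B(2ρ, u0) and z ∈ V define μ(w, z) := min{γ0‖G(w) − z‖² / ‖G'(w)*(G(w) − z)‖², γ1} (set to γ1 when the denominator vanishes), with fixed constants γ0, γ1 > 0. If {u_n} ⊂ B(2ρ, u0) and {v_n} ⊂ V are sequences with u_n → u and v_n → v, then μ(u_n, v_n) G'(u_n)*(G(u_n) − v_n) → μ(u, v) G'(u)*(G(u) − v) as n → ∞. -/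
open scoped Classical
open Filter Topology

/-- If `r n → R` and `a n → A`, then the step-size-scaled vectors
`min (γ0 ‖r n‖² / ‖a n‖²) γ1 • a n`, with step size `γ1` where `a n = 0`, converge as well. -/
theorem tendsto_min_step_smul {ι U V : Type*} [NormedAddCommGroup U] [NormedSpace ℝ U]
    [SeminormedAddCommGroup V] {l : Filter ι} {γ0 γ1 : ℝ} (hγ0 : 0 ≤ γ0) (hγ1 : 0 ≤ γ1)
    {r : ι → V} {R : V} {a : ι → U} {A : U}
    (hr : Tendsto r l (𝓝 R)) (ha : Tendsto a l (𝓝 A)) :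
    Tendsto (fun i => (if a i = 0 then γ1 else min (γ0 * ‖r i‖ ^ 2 / ‖a i‖ ^ 2) γ1) • a i) l
      (𝓝 ((if A = 0 then γ1 else min (γ0 * ‖R‖ ^ 2 / ‖A‖ ^ 2) γ1) • A)) := by
  by_cases hA : A = 0
  · subst hA
    rw [smul_zero]
    refine squeeze_zero_norm (a := fun i => γ1 * ‖a i‖) (fun i => ?_) ?_
    · rw [norm_smul]
      gcongr
      split_ifs
      · exact (Real.norm_of_nonneg hγ1).le
      · rw [Real.norm_of_nonneg (le_min (by positivity) hγ1)]
        exact min_le_right _ _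
    · simpa using ha.norm.const_mul γ1
  · rw [if_neg hA]
    have hlim : Tendsto (fun i => min (γ0 * ‖r i‖ ^ 2 / ‖a i‖ ^ 2) γ1 • a i) l
        (𝓝 (min (γ0 * ‖R‖ ^ 2 / ‖A‖ ^ 2) γ1 • A)) :=
      ((((hr.norm.pow 2).const_mul γ0).div (ha.norm.pow 2)
        (pow_ne_zero 2 (norm_ne_zero_iff.mpr hA))).min tendsto_const_nhds).smul ha
    refine hlim.congr' ?_
    filter_upwards [ha.eventually_ne hA] with i hi
    rw [if_neg hi]

/-- stability of the adaptive step-size term: if `u_n → u` and `v_n → v`, then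
`μ(u_n, v_n) G'(u_n)*(G(u_n) − v_n) → μ(u, v) G'(u)*(G(u) − v)`. -/
theorem DDIR_step_size_stability
    {U V : Type*}
    [NormedAddCommGroup U] [InnerProductSpace ℝ U] [CompleteSpace U]
    [NormedAddCommGroup V] [InnerProductSpace ℝ V] [CompleteSpace V]
    (u0 : U) (ρ : ℝ) (hρ : 0 < ρ)
    (G : U → V) (G' : U → U →L[ℝ] V)
    (hGc : ContinuousOn G (Metric.closedBall u0 (2 * ρ)))
    (hG' : ∀ w ∈ Metric.closedBall u0 (2 * ρ), HasFDerivAt G (G' w) w)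
    (hG'c : ContinuousOn G' (Metric.closedBall u0 (2 * ρ)))
    (ζ : ℝ) (hζ0 : 0 ≤ ζ) (hζ1 : ζ < 1)
    (hTCC : ∀ w ∈ Metric.closedBall u0 (2 * ρ), ∀ w' ∈ Metric.closedBall u0 (2 * ρ),
      ‖G w - G w' - G' w' (w - w')‖ ≤ ζ * ‖G w - G w'‖)
    (γ0 γ1 : ℝ) (hγ0 : 0 < γ0) (hγ1 : 0 < γ1)
    (μf : U → V → ℝ)
    (hμf : ∀ w z, μf w z =
      if ContinuousLinearMap.adjoint (G' w) (G w - z) = 0 then γ1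
      else min (γ0 * ‖G w - z‖ ^ 2 /
        ‖ContinuousLinearMap.adjoint (G' w) (G w - z)‖ ^ 2) γ1)
    (v : V) (u udag : U)
    (hu : u ∈ Metric.closedBall u0 (2 * ρ)) (hudag : udag ∈ Metric.closedBall u0 (2 * ρ))
    (hv : G udag = v)
    (un : ℕ → U) (vn : ℕ → V)
    (hun : ∀ n, un n ∈ Metric.closedBall u0 (2 * ρ))
    (hunlim : Tendsto un atTop (nhds u))
    (hvnlim : Tendsto vn atTop (nhds v)) :
    Tendsto
      (fun n => μf (un n) (vn n) •
        ContinuousLinearMap.adjoint (G' (un n)) (G (un n) - vn n))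
      atTop
      (nhds (μf u v • ContinuousLinearMap.adjoint (G' u) (G u - v))) := by
  have hwithin : Tendsto un atTop (𝓝[Metric.closedBall u0 (2 * ρ)] u) :=
    tendsto_nhdsWithin_iff.mpr ⟨hunlim, Eventually.of_forall hun⟩
  have hres : Tendsto (fun n => G (un n) - vn n) atTop (𝓝 (G u - v)) :=
    ((hGc u hu).tendsto.comp hwithin).sub hvnlim
  have hadj : Tendsto (fun n => ContinuousLinearMap.adjoint (G' (un n))) atTop
      (𝓝 (ContinuousLinearMap.adjoint (G' u))) :=
    (ContinuousLinearMap.adjoint.continuous.tendsto _).comp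
      ((hG'c u hu).tendsto.comp hwithin)
  simp only [hμf]
  exact tendsto_min_step_smul hγ0.le hγ1.le hres
    ((isBoundedBilinearMap_apply.continuous.tendsto _).comp (hadj.prodMk_nhds hres))
end

section
/- Assume G is continuous on B(2ρ, u0) with continuous Fréchet derivative, D : U → U is q-contractive with q ∈ (0,1), every solution u of G(u) = v is a fixed point of D, there exists a solution u₀† ∈ B(ρ, u0) of G(u) = v, τ > 1, C := γ − ν0(ν1 − c_q) − γ1(γ0 + ζ + (1 + ζ)/τ) > 0, and c_q ≤ ν1. For each δ > 0 and noisy data v^δ with ‖v^δ − v‖ ≤ δ, let u_k^δ denote the DDIR iterates with noisy data v^δ, and let k_dp(δ) be the first index with ‖G(u_{k_dp(δ)}^δ) − v^δ‖ ≤ τδ. Then there exists a solution u† ∈ B(ρ, u0) of G(u) = v such that for every sequence of noisy data v^{δ_l} with ‖v^{δ_l} − v‖ ≤ δ_l and 0 < δ_l → 0, one has ‖u_{k_dp(δ_l)}^{δ_l} − u†‖ → 0 as l → ∞. -/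
open scoped Classical
open Filter Topology
open scoped RealInnerProductSpace

section CappedRatio

variable {E : Type*} [NormedAddCommGroup E]

/-- The step size `min (t / ‖x‖²) c`, with the convention that it equals `c` when `x = 0`. -/
noncomputable def cappedRatio (c t : ℝ) (x : E) : ℝ :=
  if x = 0 then c else min (t / ‖x‖ ^ 2) c

lemma cappedRatio_le (c t : ℝ) (x : E) : cappedRatio c t x ≤ c := by
  unfold cappedRatio
  split_ifs
  · exact le_rfl
  · exact min_le_right _ _

lemma cappedRatio_nonneg {c t : ℝ} (hc : 0 ≤ c) (ht : 0 ≤ t) (x : E) :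
    0 ≤ cappedRatio c t x := by
  unfold cappedRatio
  split_ifs
  · exact hc
  · exact le_min (by positivity) hc

lemma cappedRatio_mul_sq_le {c t : ℝ} (ht : 0 ≤ t) (x : E) :
    cappedRatio c t x * ‖x‖ ^ 2 ≤ t := by
  unfold cappedRatio
  split_ifs with hx
  · simpa [hx] using ht
  · have hx' : 0 < ‖x‖ ^ 2 := by positivity
    exact (le_div_iff₀ hx').1 (min_le_left _ _)

lemma le_cappedRatio_iff {b c t : ℝ} (ht : 0 ≤ t) (x : E) :
    b ≤ cappedRatio c t x ↔ b ≤ c ∧ b * ‖x‖ ^ 2 ≤ t := by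
  unfold cappedRatio
  split_ifs with hx
  · simp [hx, ht]
  · have hx' : 0 < ‖x‖ ^ 2 := by positivity
    rw [le_min_iff, le_div_iff₀ hx', and_comm]

variable [NormedSpace ℝ E]

lemma cappedRatio_smul (c t : ℝ) (x : E) :
    cappedRatio c t x • x = min (t / ‖x‖ ^ 2) c • x := by
  unfold cappedRatio
  split_ifs with hx
  · simp [hx]
  · rfl

lemma tendsto_cappedRatio_smul {ι : Type*} {l : Filter ι} {c : ℝ} (hc : 0 ≤ c)
    {t : ι → ℝ} {t₀ : ℝ} {x : ι → E} {x₀ : E} (ht : ∀ i, 0 ≤ t i)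
    (htt : Tendsto t l (𝓝 t₀)) (hx : Tendsto x l (𝓝 x₀)) :
    Tendsto (fun i => cappedRatio c (t i) (x i) • x i) l (𝓝 (cappedRatio c t₀ x₀ • x₀)) := by
  by_cases h0 : x₀ = 0
  · subst h0
    rw [smul_zero]
    refine squeeze_zero_norm (a := fun i => c * ‖x i‖) (fun i => ?_) ?_
    · rw [norm_smul, Real.norm_of_nonneg (cappedRatio_nonneg hc (ht i) _)]
      exact mul_le_mul_of_nonneg_right (cappedRatio_le _ _ _) (norm_nonneg _)
    · simpa using hx.norm.const_mul c
  · simp only [cappedRatio_smul]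
    have hne : ‖x₀‖ ^ 2 ≠ 0 := by simpa using h0
    exact ((htt.div (hx.norm.pow 2) hne).min tendsto_const_nhds).smul hx

end CappedRatio

section Denoiser

lemma norm_map_sub_fixed_le {U : Type*} [NormedAddCommGroup U] {D : U → U} {q : ℝ}
    (hD : ∀ x y : U, ‖D x - D y‖ ≤ q * ‖x - y‖) {p : U} (hp : D p = p) (u : U) :
    ‖D u - p‖ ≤ q * ‖u - p‖ := by
  simpa [hp] using hD u p

variable {U : Type*} [NormedAddCommGroup U] [InnerProductSpace ℝ U]

/-- The residual `u - D_h u` of the averaged denoiser `D_h u = h D u + (1 - h) u`. -/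
noncomputable def denoiserResidual (D : U → U) (h : ℝ) (u : U) : U :=
  u - (h • D u + (1 - h) • u)

lemma denoiserResidual_eq (D : U → U) (h : ℝ) (u : U) :
    denoiserResidual D h u = h • (u - D u) := by
  unfold denoiserResidual
  module

variable {D : U → U} {q : ℝ} (hD : ∀ x y : U, ‖D x - D y‖ ≤ q * ‖x - y‖)
  {p : U} (hp : D p = p) {h : ℝ} (hh : 0 ≤ h)
include hD hp hh

lemma norm_denoiserResidual_le (u : U) :
    ‖denoiserResidual D h u‖ ≤ h * (1 + q) * ‖u - p‖ := by
  rw [denoiserResidual_eq, norm_smul, Real.norm_of_nonneg hh, mul_assoc]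
  refine mul_le_mul_of_nonneg_left ?_ hh
  have h1 := norm_sub_le (u - p) (D u - p)
  rw [sub_sub_sub_cancel_right] at h1
  linarith [norm_map_sub_fixed_le hD hp u]

lemma le_norm_denoiserResidual (u : U) :
    h * (1 - q) * ‖u - p‖ ≤ ‖denoiserResidual D h u‖ := by
  rw [denoiserResidual_eq, norm_smul, Real.norm_of_nonneg hh, mul_assoc]
  refine mul_le_mul_of_nonneg_left ?_ hh
  have h1 := norm_sub_norm_le (u - p) (D u - p)
  rw [sub_sub_sub_cancel_right] at h1
  linarith [norm_map_sub_fixed_le hD hp u]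

lemma le_inner_denoiserResidual (u : U) :
    h * (1 - q) * ‖u - p‖ ^ 2 ≤ ⟪denoiserResidual D h u, u - p⟫ := by
  rw [denoiserResidual_eq, real_inner_smul_left, mul_assoc]
  refine mul_le_mul_of_nonneg_left ?_ hh
  have h1 : u - D u = (u - p) - (D u - p) := by abel
  rw [h1, inner_sub_left, real_inner_self_eq_norm_sq]
  have h2 := real_inner_le_norm (D u - p) (u - p)
  nlinarith [norm_map_sub_fixed_le hD hp u, norm_nonneg (u - p)]

end Denoiser

section Descent

variable {U : Type*} [NormedAddCommGroup U] [InnerProductSpace ℝ U]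

lemma norm_sq_sub_smul_sub_smul_le (e a s : U) (m l : ℝ) :
    ‖e - m • a - l • s‖ ^ 2 ≤ ‖e‖ ^ 2 - 2 * m * ⟪a, e⟫ - 2 * l * ⟪s, e⟫
      + 2 * (m ^ 2 * ‖a‖ ^ 2) + 2 * (l ^ 2 * ‖s‖ ^ 2) := by
  have h1 : ‖e - m • a - l • s‖ ^ 2 = ‖e‖ ^ 2 - 2 * ⟪e, m • a + l • s⟫
      + ‖m • a + l • s‖ ^ 2 := by
    rw [sub_sub, norm_sub_sq_real]
  have h2 : ‖m • a + l • s‖ ^ 2 ≤ 2 * ‖m • a‖ ^ 2 + 2 * ‖l • s‖ ^ 2 := by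
    have := parallelogram_law_with_norm ℝ (m • a) (l • s)
    nlinarith [mul_self_nonneg ‖m • a - l • s‖]
  rw [norm_smul, norm_smul, mul_pow, mul_pow, Real.norm_eq_abs, Real.norm_eq_abs, sq_abs,
    sq_abs] at h2
  rw [inner_add_right, real_inner_smul_right, real_inner_smul_right, real_inner_comm a e,
    real_inner_comm s e] at h1
  linarith

/-- Descent of the squared error in one step, given the bounds on the step sizes and directions. -/
lemma norm_sq_step_add_le (e a s : U) {m l R h q κ γ γ0 γ1 ν0 ν1 : ℝ}
    (hκ : 0 ≤ κ) (hR : 0 ≤ R) (hγ : γ ≤ m) (hm : m ≤ γ1) (hm0 : 0 ≤ m)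
    (hma : m * ‖a‖ ^ 2 ≤ γ0 * R) (hl0 : 0 ≤ l) (hl : l ≤ ν1) (hls : l * ‖s‖ ^ 2 ≤ ν0 * R)
    (hq0 : 0 < q) (hq1 : q < 1) (hcq : (1 - q) / (1 + q) ^ 2 ≤ ν1)
    (ha : (1 - κ) * R ≤ ⟪a, e⟫) (hse : h * (1 - q) * ‖e‖ ^ 2 ≤ ⟪s, e⟫)
    (hs : ‖s‖ ^ 2 ≤ h ^ 2 * (1 + q) ^ 2 * ‖e‖ ^ 2) :
    ‖e - m • a - l • s‖ ^ 2
      + 2 * (γ - ν0 * (ν1 - (1 - q) / (1 + q) ^ 2) - γ1 * (γ0 + κ)) * R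
      + 2 * (1 - q) * (l * (h * (1 - h)) * ‖e‖ ^ 2) ≤ ‖e‖ ^ 2 := by
  set c := (1 - q) / (1 + q) ^ 2 with hc
  have hc0 : 0 ≤ c := div_nonneg (by linarith) (by positivity)
  have hcS : c * ‖s‖ ^ 2 ≤ (1 - q) * h ^ 2 * ‖e‖ ^ 2 := by
    refine (mul_le_mul_of_nonneg_left hs hc0).trans (le_of_eq ?_)
    rw [hc]
    field_simp
  have key := norm_sq_sub_smul_sub_smul_le e a s m l
  have t1 : m * ((1 - κ) * R) ≤ m * ⟪a, e⟫ := mul_le_mul_of_nonneg_left ha hm0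
  have t2 : γ * R ≤ m * R := mul_le_mul_of_nonneg_right hγ hR
  have t3 : m * (κ * R) ≤ γ1 * (κ * R) := mul_le_mul_of_nonneg_right hm (by positivity)
  have t4 : m * (m * ‖a‖ ^ 2) ≤ γ1 * (γ0 * R) :=
    mul_le_mul hm hma (by positivity) (hm0.trans hm)
  have t5 : l * (h * (1 - q) * ‖e‖ ^ 2) ≤ l * ⟪s, e⟫ := mul_le_mul_of_nonneg_left hse hl0
  have t6 : l * (c * ‖s‖ ^ 2) ≤ l * ((1 - q) * h ^ 2 * ‖e‖ ^ 2) :=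
    mul_le_mul_of_nonneg_left hcS hl0
  have t7 : (l - c) * (l * ‖s‖ ^ 2) ≤ (ν1 - c) * (l * ‖s‖ ^ 2) :=
    mul_le_mul_of_nonneg_right (by linarith) (by positivity)
  have t8 : (ν1 - c) * (l * ‖s‖ ^ 2) ≤ (ν1 - c) * (ν0 * R) :=
    mul_le_mul_of_nonneg_left hls (by linarith)
  linarith

/-- A sequence whose increments are controlled, at record indices of the residual `r`, by the
decrease of its squared norm has a convergent subsequence. -/
lemma exists_subseq_tendsto_of_records [CompleteSpace U] (e : ℕ → U) (r : ℕ → ℝ) (K : ℝ)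
    (hK : 0 ≤ K) (hr : ∀ k, 0 < r k) (hr0 : Tendsto r atTop (𝓝 0))
    (hanti : Antitone fun k => ‖e k‖ ^ 2)
    (hinc : ∀ l, (∀ i < l, r l ≤ r i) → ∀ i < l,
      ⟪e (i + 1) - e i, e l⟫ ≤ K * (‖e i‖ ^ 2 - ‖e (i + 1)‖ ^ 2)) :
    ∃ φ : ℕ → ℕ, StrictMono φ ∧ ∃ x, Tendsto (fun n => e (φ n)) atTop (𝓝 x) := by
  have hinv : Tendsto (fun k => (r k)⁻¹) atTop atTop :=
    (tendsto_nhdsWithin_iff.2 ⟨hr0, Eventually.of_forall hr⟩).inv_tendsto_nhdsGT_zero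
  obtain ⟨φ, hφ, hφr⟩ := extraction_of_frequently_atTop (frequently_high_scores hinv)
  refine ⟨φ, hφ, ?_⟩
  have hrec : ∀ n, ∀ i < φ n, r (φ n) ≤ r i := fun n i hi =>
    ((inv_lt_inv₀ (hr i) (hr (φ n))).1 (hφr n i hi)).le
  have hbd : ∀ l, (∀ i < l, r l ≤ r i) → ∀ j ≤ l,
      ‖e j - e l‖ ^ 2 ≤ (1 + 2 * K) * (‖e j‖ ^ 2 - ‖e l‖ ^ 2) := by
    intro l hl j hj
    have htel : ∀ k, j ≤ k → k ≤ l →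
        ⟪e k - e j, e l⟫ ≤ K * (‖e j‖ ^ 2 - ‖e k‖ ^ 2) := by
      intro k hjk
      induction k, hjk using Nat.le_induction with
      | base => simp
      | succ k hk ih =>
        intro hkl
        have h1 := ih (by omega)
        have h2 := hinc l hl k (by omega)
        have h3 : e (k + 1) - e j = (e (k + 1) - e k) + (e k - e j) := by abel
        rw [h3, inner_add_left]
        linarith
    have h1 := htel l hj le_rfl
    have h2 := norm_sub_sq_real (e j) (e l)
    rw [inner_sub_left, real_inner_self_eq_norm_sq] at h1
    linarith
  have hbelow : BddBelow (Set.range fun k => ‖e k‖ ^ 2) :=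
    ⟨0, by rintro _ ⟨k, rfl⟩; positivity⟩
  set L := ⨅ k, ‖e k‖ ^ 2
  have hlim : Tendsto (fun k => ‖e k‖ ^ 2) atTop (𝓝 L) := tendsto_atTop_ciInf hanti hbelow
  have hcauchy : CauchySeq fun n => e (φ n) := by
    refine cauchySeq_of_le_tendsto_0'
      (fun n => √((1 + 2 * K) * (‖e (φ n)‖ ^ 2 - L))) (fun n m hnm => ?_) ?_
    · rw [dist_eq_norm]
      refine Real.le_sqrt_of_sq_le ((hbd (φ m) (hrec m) (φ n) (hφ.monotone hnm)).trans ?_)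
      have : L ≤ ‖e (φ m)‖ ^ 2 := ciInf_le hbelow (φ m)
      exact mul_le_mul_of_nonneg_left (by linarith) (by linarith)
    · have h1 := (((hlim.comp hφ.tendsto_atTop).sub_const L).const_mul (1 + 2 * K)).sqrt
      simpa using h1
  exact cauchySeq_tendsto_of_complete hcauchy

end Descent

section Step

lemma norm_fderiv_sub_le {U V : Type*} [NormedAddCommGroup U] [NormedSpace ℝ U]
    [NormedAddCommGroup V] [NormedSpace ℝ V] {G : U → V} {G' : U → U →L[ℝ] V} {B : Set U} {ζ : ℝ}
    (hTCC : ∀ w ∈ B, ∀ w' ∈ B, ‖G w - G w' - G' w' (w - w')‖ ≤ ζ * ‖G w - G w'‖)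
    {z u : U} (hz : z ∈ B) (hu : u ∈ B) :
    ‖G' u (z - u)‖ ≤ (1 + ζ) * ‖G z - G u‖ := by
  have h1 := hTCC z hz u hu
  have h2 := norm_sub_le (G z - G u) (G z - G u - G' u (z - u))
  rw [sub_sub_cancel] at h2
  linarith

variable {U V : Type*}
  [NormedAddCommGroup U] [InnerProductSpace ℝ U] [CompleteSpace U]
  [NormedAddCommGroup V] [InnerProductSpace ℝ V] [CompleteSpace V]

/-- The gradient direction `G'(u)* (G u - w)` of the data misfit. -/
noncomputable def misfitGradient (G : U → V) (G' : U → U →L[ℝ] V) (w : V) (u : U) : U :=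
  ContinuousLinearMap.adjoint (G' u) (G u - w)

/-- One step of the DDIR iteration with data `w` and averaging parameter `h`. -/
noncomputable def ddirStep (G : U → V) (G' : U → U →L[ℝ] V) (D : U → U) (γ0 γ1 ν0 ν1 h : ℝ)
    (w : V) (u : U) : U :=
  u - cappedRatio γ1 (γ0 * ‖G u - w‖ ^ 2) (misfitGradient G G' w u) • misfitGradient G G' w u
    - cappedRatio ν1 (ν0 * ‖G u - w‖ ^ 2) (denoiserResidual D h u) • denoiserResidual D h u

variable {G : U → V} {G' : U → U →L[ℝ] V} {B : Set U}

lemma tendsto_misfitGradient (hGc : ContinuousOn G B) (hG'c : ContinuousOn G' B)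
    {ι : Type*} {l : Filter ι} {u : ι → U} {u₀ : U} {w : ι → V} {w₀ : V}
    (hu₀ : u₀ ∈ B) (huB : ∀ᶠ i in l, u i ∈ B) (hu : Tendsto u l (𝓝 u₀))
    (hw : Tendsto w l (𝓝 w₀)) :
    Tendsto (fun i => misfitGradient G G' (w i) (u i)) l (𝓝 (misfitGradient G G' w₀ u₀)) := by
  have hu' : Tendsto u l (𝓝[B] u₀) := tendsto_nhdsWithin_iff.2 ⟨hu, huB⟩
  have hA : Tendsto (fun i => ContinuousLinearMap.adjoint (G' (u i))) l
      (𝓝 (ContinuousLinearMap.adjoint (G' u₀))) :=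
    (ContinuousLinearMap.adjoint.continuous.tendsto _).comp ((hG'c u₀ hu₀).tendsto.comp hu')
  exact (isBoundedBilinearMap_apply.continuous.tendsto _).comp
    (hA.prodMk_nhds (((hGc u₀ hu₀).tendsto.comp hu').sub hw))

lemma tendsto_ddirStep (hGc : ContinuousOn G B) (hG'c : ContinuousOn G' B)
    {D : U → U} (hD : Continuous D) {γ0 γ1 ν0 ν1 : ℝ} (hγ0 : 0 ≤ γ0) (hγ1 : 0 ≤ γ1)
    (hν0 : 0 ≤ ν0) (hν1 : 0 ≤ ν1) (h : ℝ)
    {ι : Type*} {l : Filter ι} {u : ι → U} {u₀ : U} {w : ι → V} {w₀ : V}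
    (hu₀ : u₀ ∈ B) (huB : ∀ᶠ i in l, u i ∈ B) (hu : Tendsto u l (𝓝 u₀))
    (hw : Tendsto w l (𝓝 w₀)) :
    Tendsto (fun i => ddirStep G G' D γ0 γ1 ν0 ν1 h (w i) (u i)) l
      (𝓝 (ddirStep G G' D γ0 γ1 ν0 ν1 h w₀ u₀)) := by
  have hr : Tendsto (fun i => ‖G (u i) - w i‖ ^ 2) l (𝓝 (‖G u₀ - w₀‖ ^ 2)) :=
    ((((hGc u₀ hu₀).tendsto.comp (tendsto_nhdsWithin_iff.2 ⟨hu, huB⟩)).sub hw).norm).pow 2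
  have hs : Continuous (denoiserResidual D h) := by
    unfold denoiserResidual
    fun_prop
  refine (hu.sub ?_).sub ?_
  · exact tendsto_cappedRatio_smul hγ1 (fun i => by positivity) (hr.const_mul γ0)
      (tendsto_misfitGradient hGc hG'c hu₀ huB hu hw)
  · exact tendsto_cappedRatio_smul hν1 (fun i => by positivity) (hr.const_mul ν0)
      ((hs.tendsto u₀).comp hu)

variable {ζ : ℝ}
  (hTCC : ∀ w ∈ B, ∀ w' ∈ B, ‖G w - G w' - G' w' (w - w')‖ ≤ ζ * ‖G w - G w'‖)
include hTCC

lemma le_inner_misfitGradient (hζ0 : 0 ≤ ζ) {τ δ : ℝ} (hτ : 0 < τ) {p u : U} {w : V}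
    (hp : p ∈ B) (hu : u ∈ B) (hw : ‖w - G p‖ ≤ δ) (hδ : τ * δ ≤ ‖G u - w‖) :
    (1 - (ζ + (1 + ζ) / τ)) * ‖G u - w‖ ^ 2 ≤ ⟪misfitGradient G G' w u, u - p⟫ := by
  unfold misfitGradient
  rw [ContinuousLinearMap.adjoint_inner_left]
  set r := G u - w with hr
  have hδ' : δ ≤ ‖r‖ / τ := by rwa [le_div_iff₀ hτ, mul_comm]
  have h1 := hTCC p hp u hu
  have h2 : ‖G p - G u‖ ≤ ‖r‖ + δ := by
    have h3 : G p - G u = -(r + (w - G p)) := by rw [hr]; abel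
    rw [h3, norm_neg]
    exact (norm_add_le _ _).trans (by linarith)
  have h4 : ‖r - G' u (u - p)‖ ≤ (ζ + (1 + ζ) / τ) * ‖r‖ := by
    have h5 : r - G' u (u - p) = -(G p - G u - G' u (p - u)) - (w - G p) := by
      rw [hr, ← neg_sub u p, map_neg]; abel
    have h6 := norm_sub_le (-(G p - G u - G' u (p - u))) (w - G p)
    rw [← h5, norm_neg] at h6
    have h7 : (ζ + (1 + ζ) / τ) * ‖r‖ = ζ * ‖r‖ + (1 + ζ) * (‖r‖ / τ) := by ring
    rw [h7]
    have h8 := mul_le_mul_of_nonneg_left h2 hζ0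
    have h9 := mul_le_mul_of_nonneg_left hδ' (by linarith : 0 ≤ 1 + ζ)
    linarith
  have h10 := real_inner_le_norm r (r - G' u (u - p))
  rw [inner_sub_right, real_inner_self_eq_norm_sq] at h10
  nlinarith [mul_le_mul_of_nonneg_left h4 (norm_nonneg r)]

lemma neg_inner_misfitGradient_le (hζ0 : 0 ≤ ζ) {p u z : U} (hp : p ∈ B) (hu : u ∈ B) (hz : z ∈ B)
    (hzu : ‖G z - G p‖ ≤ ‖G u - G p‖) :
    -⟪misfitGradient G G' (G p) u, z - p⟫ ≤ 3 * (1 + ζ) * ‖G u - G p‖ ^ 2 := by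
  unfold misfitGradient
  rw [ContinuousLinearMap.adjoint_inner_left]
  set R := ‖G u - G p‖ with hR
  have h1 := norm_fderiv_sub_le hTCC hz hu
  have h2 := norm_fderiv_sub_le hTCC hp hu
  rw [norm_sub_rev (G p), ← hR] at h2
  have h3 : ‖G z - G u‖ ≤ 2 * R := by
    have := norm_sub_le (G z - G p) (G u - G p)
    rw [sub_sub_sub_cancel_right] at this
    linarith
  have h4 : ‖G' u (z - p)‖ ≤ 3 * (1 + ζ) * R := by
    have h5 : G' u (z - p) = G' u (z - u) - G' u (p - u) := by
      rw [← map_sub, sub_sub_sub_cancel_right]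
    have h6 := norm_sub_le (G' u (z - u)) (G' u (p - u))
    rw [← h5] at h6
    have h7 := mul_le_mul_of_nonneg_left h3 (by linarith : 0 ≤ 1 + ζ)
    linarith
  have h8 := (neg_le_abs _).trans (abs_real_inner_le_norm (G u - G p) (G' u (z - p)))
  have h9 := mul_le_mul_of_nonneg_left h4 (norm_nonneg (G u - G p))
  rw [← hR] at h8 h9
  linarith

variable (hζ0 : 0 ≤ ζ) {D : U → U} {q : ℝ} (hq0 : 0 < q) (hq1 : q < 1)
  (hD : ∀ x y : U, ‖D x - D y‖ ≤ q * ‖x - y‖)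
  {γ γ0 γ1 ν0 ν1 τ h : ℝ} (hγ : 0 < γ) (hγγ1 : γ ≤ γ1) (hγ0 : 0 < γ0)
  (hν0 : 0 < ν0) (hν1 : 0 < ν1)
  (hτ : 0 < τ) (hcq : (1 - q) / (1 + q) ^ 2 ≤ ν1) (hh : h ∈ Set.Ioo (0 : ℝ) 1)
  {p u : U} (hp : p ∈ B) (hDp : D p = p) (hu : u ∈ B)
include hζ0 hq0 hq1 hD hγ hγγ1 hγ0 hν0 hν1 hτ hcq hh hp hDp hu

lemma norm_sq_ddirStep_sub_add_le {δ : ℝ} {w : V} (hw : ‖w - G p‖ ≤ δ)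
    (hδ : τ * δ ≤ ‖G u - w‖)
    (hμ : γ * ‖misfitGradient G G' w u‖ ^ 2 ≤ γ0 * ‖G u - w‖ ^ 2) :
    ‖ddirStep G G' D γ0 γ1 ν0 ν1 h w u - p‖ ^ 2
      + 2 * (γ - ν0 * (ν1 - (1 - q) / (1 + q) ^ 2) - γ1 * (γ0 + ζ + (1 + ζ) / τ))
        * ‖G u - w‖ ^ 2
      + 2 * (1 - q) * (cappedRatio ν1 (ν0 * ‖G u - w‖ ^ 2) (denoiserResidual D h u)
        * (h * (1 - h)) * ‖u - p‖ ^ 2) ≤ ‖u - p‖ ^ 2 := by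
  have hγm := (le_cappedRatio_iff (by positivity) _).2 ⟨hγγ1, hμ⟩
  have hs : ‖denoiserResidual D h u‖ ^ 2 ≤ h ^ 2 * (1 + q) ^ 2 * ‖u - p‖ ^ 2 := by
    rw [← mul_pow, ← mul_pow]
    exact pow_le_pow_left₀ (norm_nonneg _) (norm_denoiserResidual_le hD hDp hh.1.le u) 2
  have key := norm_sq_step_add_le (u - p) (misfitGradient G G' w u) (denoiserResidual D h u)
    (κ := ζ + (1 + ζ) / τ) (ν0 := ν0) (γ0 := γ0) (by positivity) (sq_nonneg ‖G u - w‖)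
    hγm (cappedRatio_le _ _ _)
    (hγ.le.trans hγm) (cappedRatio_mul_sq_le (by positivity) _)
    (cappedRatio_nonneg hν1.le (by positivity) _) (cappedRatio_le _ _ _)
    (cappedRatio_mul_sq_le (by positivity) _) hq0 hq1 hcq
    (le_inner_misfitGradient hTCC hζ0 hτ hp hu hw hδ)
    (le_inner_denoiserResidual hD hDp hh.1.le u) hs
  have hstep : ddirStep G G' D γ0 γ1 ν0 ν1 h w u - p = (u - p)
      - cappedRatio γ1 (γ0 * ‖G u - w‖ ^ 2) (misfitGradient G G' w u) • misfitGradient G G' w u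
      - cappedRatio ν1 (ν0 * ‖G u - w‖ ^ 2) (denoiserResidual D h u)
        • denoiserResidual D h u := by
    unfold ddirStep
    abel
  rw [hstep, add_assoc γ0]
  exact key

lemma mul_norm_sq_residual_le {δ : ℝ} {w : V} (hw : ‖w - G p‖ ≤ δ) (hδ : τ * δ ≤ ‖G u - w‖)
    (hμ : γ * ‖misfitGradient G G' w u‖ ^ 2 ≤ γ0 * ‖G u - w‖ ^ 2) :
    2 * (γ - ν0 * (ν1 - (1 - q) / (1 + q) ^ 2) - γ1 * (γ0 + ζ + (1 + ζ) / τ)) * ‖G u - w‖ ^ 2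
      ≤ ‖u - p‖ ^ 2 - ‖ddirStep G G' D γ0 γ1 ν0 ν1 h w u - p‖ ^ 2 := by
  have h1 := norm_sq_ddirStep_sub_add_le hTCC hζ0 hq0 hq1 hD hγ hγγ1 hγ0 hν0 hν1 hτ hcq hh hp hDp
    hu hw hδ hμ
  have h2 : 0 ≤ 2 * (1 - q) * (cappedRatio ν1 (ν0 * ‖G u - w‖ ^ 2) (denoiserResidual D h u)
        * (h * (1 - h)) * ‖u - p‖ ^ 2) := by
    have := cappedRatio_nonneg hν1.le (by positivity : 0 ≤ ν0 * ‖G u - w‖ ^ 2)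
      (denoiserResidual D h u)
    have := hh.1
    have : 0 < 1 - h := by linarith [hh.2]
    have : 0 < 1 - q := by linarith
    positivity
  linarith

variable (hC : 0 < γ - ν0 * (ν1 - (1 - q) / (1 + q) ^ 2) - γ1 * (γ0 + ζ + (1 + ζ) / τ))
include hC

lemma norm_ddirStep_sub_le {δ : ℝ} {w : V} (hw : ‖w - G p‖ ≤ δ) (hδ : τ * δ ≤ ‖G u - w‖)
    (hμ : γ * ‖misfitGradient G G' w u‖ ^ 2 ≤ γ0 * ‖G u - w‖ ^ 2) :
    ‖ddirStep G G' D γ0 γ1 ν0 ν1 h w u - p‖ ≤ ‖u - p‖ := by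
  have h1 := mul_norm_sq_residual_le hTCC hζ0 hq0 hq1 hD hγ hγγ1 hγ0 hν0 hν1 hτ hcq hh hp hDp hu
    hw hδ hμ
  have h2 : 0 ≤ 2 * (γ - ν0 * (ν1 - (1 - q) / (1 + q) ^ 2) - γ1 * (γ0 + ζ + (1 + ζ) / τ))
      * ‖G u - w‖ ^ 2 := by positivity
  exact le_of_sq_le_sq (by linarith) (norm_nonneg _)

/-- For exact data, an increment tested against the error at a later point with smaller error
and smaller residual is controlled by the decrease of the squared error. -/
lemma inner_ddirStep_sub_le
    (hμ : γ * ‖misfitGradient G G' (G p) u‖ ^ 2 ≤ γ0 * ‖G u - G p‖ ^ 2)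
    {z : U} (hz : z ∈ B) (hzG : ‖G z - G p‖ ≤ ‖G u - G p‖) (hzp : ‖z - p‖ ≤ ‖u - p‖) :
    ⟪ddirStep G G' D γ0 γ1 ν0 ν1 h (G p) u - u, z - p⟫ ≤
      ((γ1 * (3 * (1 + ζ)) + 2 * (ν0 / (1 - q) ^ 2))
        / (2 * (γ - ν0 * (ν1 - (1 - q) / (1 + q) ^ 2) - γ1 * (γ0 + ζ + (1 + ζ) / τ)))
        + 1 / (1 - q)) *
      (‖u - p‖ ^ 2 - ‖ddirStep G G' D γ0 γ1 ν0 ν1 h (G p) u - p‖ ^ 2) := by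
  have hw : ‖G p - G p‖ ≤ 0 := by simp
  have hδ : τ * 0 ≤ ‖G u - G p‖ := by simp
  have hdesc := norm_sq_ddirStep_sub_add_le hTCC hζ0 hq0 hq1 hD hγ hγγ1 hγ0 hν0 hν1 hτ hcq hh hp
    hDp hu hw hδ hμ
  have hres := mul_norm_sq_residual_le hTCC hζ0 hq0 hq1 hD hγ hγγ1 hγ0 hν0 hν1 hτ hcq hh hp hDp hu
    hw hδ hμ
  set C := γ - ν0 * (ν1 - (1 - q) / (1 + q) ^ 2) - γ1 * (γ0 + ζ + (1 + ζ) / τ)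
  set Δ := ‖u - p‖ ^ 2 - ‖ddirStep G G' D γ0 γ1 ν0 ν1 h (G p) u - p‖ ^ 2
  have hgrad := neg_inner_misfitGradient_le hTCC hζ0 hp hu hz hzG
  have hinner : ⟪ddirStep G G' D γ0 γ1 ν0 ν1 h (G p) u - u, z - p⟫
      = cappedRatio γ1 (γ0 * ‖G u - G p‖ ^ 2) (misfitGradient G G' (G p) u)
          * -⟪misfitGradient G G' (G p) u, z - p⟫
        + cappedRatio ν1 (ν0 * ‖G u - G p‖ ^ 2) (denoiserResidual D h u)
          * -⟪denoiserResidual D h u, z - p⟫ := by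
    unfold ddirStep
    rw [sub_sub u, sub_sub_cancel_left, inner_neg_left, inner_add_left, real_inner_smul_left,
      real_inner_smul_left]
    ring
  have hm0 := cappedRatio_nonneg (hγ.le.trans hγγ1)
    (by positivity : 0 ≤ γ0 * ‖G u - G p‖ ^ 2) (misfitGradient G G' (G p) u)
  have hm1 := cappedRatio_le γ1 (γ0 * ‖G u - G p‖ ^ 2) (misfitGradient G G' (G p) u)
  have hl0 := cappedRatio_nonneg hν1.le
    (by positivity : 0 ≤ ν0 * ‖G u - G p‖ ^ 2) (denoiserResidual D h u)
  have hls := cappedRatio_mul_sq_le (c := ν1)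
    (by positivity : 0 ≤ ν0 * ‖G u - G p‖ ^ 2) (denoiserResidual D h u)
  set m := cappedRatio γ1 (γ0 * ‖G u - G p‖ ^ 2) (misfitGradient G G' (G p) u)
  set l := cappedRatio ν1 (ν0 * ‖G u - G p‖ ^ 2) (denoiserResidual D h u)
  set R := ‖G u - G p‖ ^ 2
  have hR0 : 0 ≤ R := sq_nonneg _
  have h1q : 0 < 1 - q := by linarith
  have hh0 := hh.1
  have hh1 : 0 < 1 - h := by linarith [hh.2]
  have t1 : m * -⟪misfitGradient G G' (G p) u, z - p⟫ ≤ γ1 * (3 * (1 + ζ)) * R := by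
    rw [mul_assoc γ1]
    exact (mul_le_mul_of_nonneg_left hgrad hm0).trans
      (mul_le_mul_of_nonneg_right hm1 (by positivity))
  have t2 : -⟪denoiserResidual D h u, z - p⟫ ≤ 2 * (h * ‖u - p‖ ^ 2) := by
    have h1 := (neg_le_abs _).trans (abs_real_inner_le_norm (denoiserResidual D h u) (z - p))
    have h2 := mul_le_mul (norm_denoiserResidual_le hD hDp hh0.le u) hzp (norm_nonneg _)
      (by positivity)
    have h3 : 0 ≤ h * ‖u - p‖ ^ 2 := by positivity
    have h4 := mul_le_mul_of_nonneg_right hq1.le h3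
    linarith
  have t3 : l * (h ^ 2 * ‖u - p‖ ^ 2) ≤ ν0 / (1 - q) ^ 2 * R := by
    have h1 := pow_le_pow_left₀ (by positivity) (le_norm_denoiserResidual hD hDp hh0.le u) 2
    have h2 := (mul_le_mul_of_nonneg_left h1 hl0).trans hls
    rw [div_mul_eq_mul_div, le_div_iff₀ (by positivity)]
    linarith
  have t4 : l * (h * (1 - h)) * ‖u - p‖ ^ 2 ≤ 1 / (1 - q) * Δ / 2 := by
    rw [one_div_mul_eq_div, div_div, le_div_iff₀ (by positivity)]
    have : 0 ≤ 2 * C * R := by positivity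
    linarith
  have t5 : R ≤ Δ / (2 * C) := by
    rw [le_div_iff₀ (by positivity)]
    linarith
  have hγ1 : 0 < γ1 := hγ.trans_le hγγ1
  have t6 : (γ1 * (3 * (1 + ζ)) + 2 * (ν0 / (1 - q) ^ 2)) * R
      ≤ (γ1 * (3 * (1 + ζ)) + 2 * (ν0 / (1 - q) ^ 2)) * (Δ / (2 * C)) :=
    mul_le_mul_of_nonneg_left t5 (by positivity)
  have t7 := mul_le_mul_of_nonneg_left t2 hl0
  rw [hinner, add_mul, div_mul_eq_mul_div, mul_div_assoc]
  linarith

end Step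

section ExactData

variable {U V : Type*}
  [NormedAddCommGroup U] [InnerProductSpace ℝ U] [CompleteSpace U]
  [NormedAddCommGroup V] [InnerProductSpace ℝ V] [CompleteSpace V]

/-- The iterates for exact data come arbitrarily close to the unique solution. -/
lemma exists_exact_iterate_norm_sub_lt {G : U → V} {G' : U → U →L[ℝ] V} {B : Set U} {ζ : ℝ}
    (hTCC : ∀ w ∈ B, ∀ w' ∈ B, ‖G w - G w' - G' w' (w - w')‖ ≤ ζ * ‖G w - G w'‖)
    (hζ0 : 0 ≤ ζ) {D : U → U} {q : ℝ} (hq0 : 0 < q) (hq1 : q < 1)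
    (hD : ∀ x y : U, ‖D x - D y‖ ≤ q * ‖x - y‖)
    {γ γ0 γ1 ν0 ν1 τ : ℝ} (hγ : 0 < γ) (hγγ1 : γ ≤ γ1) (hγ0 : 0 < γ0)
    (hν0 : 0 < ν0) (hν1 : 0 < ν1)
    (hτ : 0 < τ) (hcq : (1 - q) / (1 + q) ^ 2 ≤ ν1)
    (hC : 0 < γ - ν0 * (ν1 - (1 - q) / (1 + q) ^ 2) - γ1 * (γ0 + ζ + (1 + ζ) / τ))
    {hs : ℕ → ℝ} (hhs : ∀ k, hs k ∈ Set.Ioo (0 : ℝ) 1)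
    {p : U} (hp : p ∈ B) (hDp : D p = p) (huniq : ∀ w, G w = G p → w = p)
    (hB : IsClosed B) (hGc : ContinuousOn G B)
    {x : ℕ → U} (hxB : ∀ k, x k ∈ B)
    (hx : ∀ k, x (k + 1) = ddirStep G G' D γ0 γ1 ν0 ν1 (hs k) (G p) (x k))
    (hμ : ∀ k, γ * ‖misfitGradient G G' (G p) (x k)‖ ^ 2 ≤ γ0 * ‖G (x k) - G p‖ ^ 2)
    (hne : ∀ k, G (x k) ≠ G p) {ε : ℝ} (hε : 0 < ε) :
    ∃ k, ‖x k - p‖ < ε := by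
  have hres : ∀ k, _ := fun k => mul_norm_sq_residual_le hTCC hζ0 hq0 hq1 hD hγ hγγ1 hγ0 hν0 hν1 hτ
    hcq (hhs k) hp hDp (hxB k) (δ := 0) (w := G p) (by simp) (by simp) (hμ k)
  have hinc : ∀ k l, _ → _ → _ := fun k l => inner_ddirStep_sub_le hTCC hζ0 hq0 hq1 hD hγ hγγ1 hγ0
    hν0 hν1 hτ hcq (hhs k) hp hDp (hxB k) hC (hμ k) (hxB l)
  simp only [← hx] at hres hinc
  set C := γ - ν0 * (ν1 - (1 - q) / (1 + q) ^ 2) - γ1 * (γ0 + ζ + (1 + ζ) / τ)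
  have hanti : Antitone fun k => ‖x k - p‖ ^ 2 := by
    refine antitone_nat_of_succ_le fun k => ?_
    have h1 := hres k
    have h2 : 0 ≤ 2 * C * ‖G (x k) - G p‖ ^ 2 := by positivity
    linarith
  have hanti' : ∀ i l, i ≤ l → ‖x l - p‖ ≤ ‖x i - p‖ := fun i l hil =>
    le_of_sq_le_sq (hanti hil) (norm_nonneg _)
  have hr0 : Tendsto (fun k => ‖G (x k) - G p‖) atTop (𝓝 0) := by
    have hlim := tendsto_atTop_ciInf hanti ⟨0, by rintro _ ⟨k, rfl⟩; positivity⟩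
    have hdiff := (hlim.sub (hlim.comp (tendsto_add_atTop_nat 1))).div_const (2 * C)
    simp only [sub_self, zero_div, Function.comp_apply] at hdiff
    have hsq : Tendsto (fun k => ‖G (x k) - G p‖ ^ 2) atTop (𝓝 0) := by
      refine squeeze_zero (fun k => sq_nonneg _) (fun k => ?_) hdiff
      rw [le_div_iff₀ (by positivity)]
      linarith [hres k]
    simpa [Real.sqrt_sq (norm_nonneg _)] using hsq.sqrt
  have h1q : 0 < 1 - q := by linarith
  have hγ1 : 0 < γ1 := hγ.trans_le hγγ1
  obtain ⟨φ, hφ, y, hy⟩ := exists_subseq_tendsto_of_records (fun k => x k - p)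
    (fun k => ‖G (x k) - G p‖)
    ((γ1 * (3 * (1 + ζ)) + 2 * (ν0 / (1 - q) ^ 2)) / (2 * C) + 1 / (1 - q)) (by positivity)
    (fun k => norm_pos_iff.2 (sub_ne_zero.2 (hne k))) hr0 hanti
    (fun l hl i hi => by
      rw [sub_sub_sub_cancel_right]
      exact hinc i l (hl i hi) (hanti' i l hi.le))
  have hxlim : Tendsto (fun n => x (φ n)) atTop (𝓝 (y + p)) := by
    simpa using hy.add_const p
  have hyB : y + p ∈ B := hB.mem_of_tendsto hxlim (Eventually.of_forall fun n => hxB _)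
  have hG : G (y + p) = G p := by
    have h1 : Tendsto (fun n => G (x (φ n))) atTop (𝓝 (G (y + p))) :=
      (hGc _ hyB).tendsto.comp
        (tendsto_nhdsWithin_iff.2 ⟨hxlim, Eventually.of_forall fun n => hxB _⟩)
    exact tendsto_nhds_unique h1
      ((tendsto_iff_norm_sub_tendsto_zero.2 hr0).comp hφ.tendsto_atTop)
  rw [huniq _ hG] at hxlim
  obtain ⟨n, hn⟩ := (Metric.tendsto_nhds.1 hxlim ε hε).exists
  exact ⟨φ n, by rwa [← dist_eq_norm]⟩

end ExactData

/-- the DDIR method with the discrepancy-principle stopping rule is a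
convergent regularization method: there is a solution `u† ∈ B(ρ, u0)` of `G(u) = v` such
that for every sequence of noisy data `v^{δ_l}` with noise levels `δ_l → 0`, the stopped
iterates converge to `u†`. -/
theorem DDIR_regularization_convergence
    {U V : Type*}
    [NormedAddCommGroup U] [InnerProductSpace ℝ U] [CompleteSpace U]
    [NormedAddCommGroup V] [InnerProductSpace ℝ V] [CompleteSpace V]
    (u0 : U) (ρ : ℝ) (hρ : 0 < ρ)
    (G : U → V) (G' : U → U →L[ℝ] V)
    (hGc : ContinuousOn G (Metric.closedBall u0 (2 * ρ)))
    (hG' : ∀ w ∈ Metric.closedBall u0 (2 * ρ), HasFDerivAt G (G' w) w)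
    (hG'c : ContinuousOn G' (Metric.closedBall u0 (2 * ρ)))
    (ζ : ℝ) (hζ0 : 0 ≤ ζ) (hζ1 : ζ < 1)
    (hTCC : ∀ w ∈ Metric.closedBall u0 (2 * ρ), ∀ w' ∈ Metric.closedBall u0 (2 * ρ),
      ‖G w - G w' - G' w' (w - w')‖ ≤ ζ * ‖G w - G w'‖)
    (D : U → U) (q : ℝ) (hq0 : 0 < q) (hq1 : q < 1)
    (hD : ∀ x y : U, ‖D x - D y‖ ≤ q * ‖x - y‖)
    (v : V)
    (hsol : ∀ w : U, G w = v → D w = w)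
    (u0dag : U) (hu0dag : u0dag ∈ Metric.closedBall u0 ρ) (hv0 : G u0dag = v)
    (γ γ0 γ1 ν0 ν1 τ : ℝ)
    (hγ : 0 < γ) (hγ0 : 0 < γ0) (hγ1 : 0 < γ1) (hν0 : 0 < ν0) (hν1 : 0 < ν1)
    (hτ : 1 < τ)
    (hcq : (1 - q) / (1 + q) ^ 2 ≤ ν1)
    (hC : 0 < γ - ν0 * (ν1 - (1 - q) / (1 + q) ^ 2) - γ1 * (γ0 + ζ + (1 + ζ) / τ))
    (hs : ℕ → ℝ) (hhs : ∀ k, hs k ∈ Set.Ioo (0 : ℝ) 1) :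
    ∃ udag ∈ Metric.closedBall u0 ρ, G udag = v ∧
      ∀ (δs : ℕ → ℝ) (vδ : ℕ → V) (useq : ℕ → ℕ → U)
        (μs lams : ℕ → ℕ → ℝ) (kdp : ℕ → ℕ),
        (∀ l, 0 < δs l) →
        Tendsto δs atTop (nhds 0) →
        (∀ l, ‖vδ l - v‖ ≤ δs l) →
        (∀ l, useq l 0 = u0) →
        (∀ l k, μs l k =
          if ContinuousLinearMap.adjoint (G' (useq l k)) (G (useq l k) - vδ l) = 0 then γ1
          else min (γ0 * ‖G (useq l k) - vδ l‖ ^ 2 /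
            ‖ContinuousLinearMap.adjoint (G' (useq l k)) (G (useq l k) - vδ l)‖ ^ 2) γ1) →
        (∀ l k, γ ≤ μs l k) →
        (∀ l k, lams l k =
          if useq l k = hs k • D (useq l k) + (1 - hs k) • useq l k then 0
          else min (ν0 * ‖G (useq l k) - vδ l‖ ^ 2 /
            ‖useq l k - (hs k • D (useq l k) + (1 - hs k) • useq l k)‖ ^ 2) ν1) →
        (∀ l k, useq l (k + 1) = useq l k
          - μs l k • (ContinuousLinearMap.adjoint (G' (useq l k)) (G (useq l k) - vδ l))
          - lams l k • (useq l k - (hs k • D (useq l k) + (1 - hs k) • useq l k))) →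
        (∀ l, ‖G (useq l (kdp l)) - vδ l‖ ≤ τ * δs l) →
        (∀ l, ∀ k < kdp l, τ * δs l < ‖G (useq l k) - vδ l‖) →
        Tendsto (fun l => ‖useq l (kdp l) - udag‖) atTop (nhds 0) := by
  subst hv0
  have hDp : D u0dag = u0dag := hsol _ rfl
  have huniq : ∀ w, G w = G u0dag → w = u0dag := by
    intro w hw
    have h1 := norm_map_sub_fixed_le hD hDp w
    rw [hsol w hw] at h1
    have h2 : ‖w - u0dag‖ = 0 := by nlinarith [norm_nonneg (w - u0dag)]
    exact sub_eq_zero.1 (norm_eq_zero.1 h2)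
  refine ⟨u0dag, hu0dag, rfl, ?_⟩
  intro δs vδ useq μs lams kdp hδ0 hδlim hvδ hu0 hμs hμγ hlams hrec hdiscrepancy hfirst
  have hτ0 : 0 < τ := by linarith
  set B := Metric.closedBall u0 (2 * ρ)
  have hball : Metric.closedBall u0dag ρ ⊆ B := by
    refine Metric.closedBall_subset_closedBall' ?_
    rw [Metric.mem_closedBall] at hu0dag
    linarith
  have hpB : u0dag ∈ B := hball (Metric.mem_closedBall_self hρ.le)
  have hμcap : ∀ l k, γ ≤ γ1 ∧ γ * ‖misfitGradient G G' (vδ l) (useq l k)‖ ^ 2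
      ≤ γ0 * ‖G (useq l k) - vδ l‖ ^ 2 := by
    intro l k
    refine (le_cappedRatio_iff (by positivity) _).1 ?_
    have h1 := hμγ l k
    rw [hμs l k] at h1
    exact h1
  have hγγ1 : γ ≤ γ1 := (hμcap 0 0).1
  have hstep : ∀ l k, useq l (k + 1)
      = ddirStep G G' D γ0 γ1 ν0 ν1 (hs k) (vδ l) (useq l k) := by
    intro l k
    have hl : lams l k • (useq l k - (hs k • D (useq l k) + (1 - hs k) • useq l k))
        = cappedRatio ν1 (ν0 * ‖G (useq l k) - vδ l‖ ^ 2) (denoiserResidual D (hs k) (useq l k))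
          • denoiserResidual D (hs k) (useq l k) := by
      rw [cappedRatio_smul, hlams l k, denoiserResidual]
      split_ifs with h0
      · rw [sub_eq_zero.2 h0, smul_zero, smul_zero]
      · rfl
    rw [hrec l k, hl, hμs l k]
    rfl
  have hmono : ∀ l k, k < kdp l → useq l k ∈ Metric.closedBall u0dag ρ →
      ‖useq l (k + 1) - u0dag‖ ≤ ‖useq l k - u0dag‖ := by
    intro l k hk hmem
    rw [hstep l k]
    exact norm_ddirStep_sub_le hTCC hζ0 hq0 hq1 hD hγ hγγ1 hγ0 hν0 hν1 hτ0 hcq (hhs k) hpB hDp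
      (hball hmem) hC (hvδ l) (hfirst l k hk).le (hμcap l k).2
  have hin : ∀ l k, k ≤ kdp l → useq l k ∈ Metric.closedBall u0dag ρ := by
    intro l k
    induction k with
    | zero => intro _; rwa [hu0 l, Metric.mem_closedBall_comm]
    | succ k ih =>
      intro hk
      have hmem := ih (by omega)
      have h1 := hmono l k (by omega) hmem
      rw [mem_closedBall_iff_norm] at hmem ⊢
      exact h1.trans hmem
  have hle : ∀ l k, k ≤ kdp l → ‖useq l (kdp l) - u0dag‖ ≤ ‖useq l k - u0dag‖ := by
    intro l k hk
    induction hk using Nat.decreasingInduction with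
    | self => exact le_rfl
    | of_succ k hk ih => exact ih.trans (hmono l k hk (hin l k hk.le))
  have hvlim : Tendsto vδ atTop (𝓝 (G u0dag)) :=
    tendsto_iff_norm_sub_tendsto_zero.2 (squeeze_zero (fun _ => norm_nonneg _) hvδ hδlim)
  have hDc : Continuous D :=
    (LipschitzWith.of_dist_le_mul (K := ⟨q, hq0.le⟩) fun x y => by
      rw [dist_eq_norm, dist_eq_norm]
      exact hD x y).continuous
  let x : ℕ → U := fun k =>
    Nat.rec u0 (fun k u => ddirStep G G' D γ0 γ1 ν0 ν1 (hs k) (G u0dag) u) k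
  have hxmem : ∀ k, (∀ᶠ l in atTop, k ≤ kdp l) →
      Tendsto (fun l => useq l k) atTop (𝓝 (x k)) → x k ∈ Metric.closedBall u0dag ρ :=
    fun k hk hlim => Metric.isClosed_closedBall.mem_of_tendsto hlim (hk.mono fun l => hin l k)
  have hconv : ∀ k, (∀ i < k, G (x i) ≠ G u0dag) → (∀ᶠ l in atTop, k ≤ kdp l) ∧
      Tendsto (fun l => useq l k) atTop (𝓝 (x k)) := by
    intro k
    induction k with
    | zero => exact fun _ => ⟨by simp, by simp only [hu0]; exact tendsto_const_nhds⟩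
    | succ k ih =>
      intro hne
      obtain ⟨hk, hlim⟩ := ih fun i hi => hne i (by omega)
      have hxB := hball (hxmem k hk hlim)
      have huB : ∀ᶠ l in atTop, useq l k ∈ B := hk.mono fun l hl => hball (hin l k hl)
      constructor
      · have hres : Tendsto (fun l => ‖G (useq l k) - vδ l‖) atTop (𝓝 ‖G (x k) - G u0dag‖) :=
          (((hGc _ hxB).tendsto.comp (tendsto_nhdsWithin_iff.2 ⟨hlim, huB⟩)).sub hvlim).norm
        have hpos : τ * 0 < ‖G (x k) - G u0dag‖ := by
          rw [mul_zero]
          exact norm_pos_iff.2 (sub_ne_zero.2 (hne k (by omega)))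
        filter_upwards [hk, (hδlim.const_mul τ).eventually_lt hres hpos] with l hl hlt
        refine Nat.succ_le_of_lt (lt_of_le_of_ne hl ?_)
        rintro rfl
        exact absurd (hdiscrepancy l) (not_le.2 hlt)
      · simp only [hstep]
        exact tendsto_ddirStep hGc hG'c hDc hγ0.le hγ1.le hν0.le hν1.le (hs k) hxB huB hlim hvlim
  have hsmall : ∀ ε > 0, ∃ k, (∀ i < k, G (x i) ≠ G u0dag) ∧ ‖x k - u0dag‖ < ε := by
    intro ε hε
    by_cases hex : ∃ j, G (x j) = G u0dag
    · refine ⟨Nat.find hex, fun i hi => Nat.find_min hex hi, ?_⟩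
      rw [huniq _ (Nat.find_spec hex)]
      simpa using hε
    · have hne : ∀ k, G (x k) ≠ G u0dag := fun k h => hex ⟨k, h⟩
      have hconv' := fun k => hconv k fun i _ => hne i
      have hxB : ∀ k, x k ∈ B := fun k => hball (hxmem k (hconv' k).1 (hconv' k).2)
      have hμx : ∀ k, γ * ‖misfitGradient G G' (G u0dag) (x k)‖ ^ 2
          ≤ γ0 * ‖G (x k) - G u0dag‖ ^ 2 := by
        intro k
        obtain ⟨hk, hlim⟩ := hconv' k
        have huB : ∀ᶠ l in atTop, useq l k ∈ B := hk.mono fun l hl => hball (hin l k hl)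
        have hgrad := tendsto_misfitGradient hGc hG'c (hxB k) huB hlim hvlim
        have hres := ((hGc _ (hxB k)).tendsto.comp
          (tendsto_nhdsWithin_iff.2 ⟨hlim, huB⟩)).sub hvlim
        exact le_of_tendsto_of_tendsto' ((hgrad.norm.pow 2).const_mul γ)
          ((hres.norm.pow 2).const_mul γ0) fun l => (hμcap l k).2
      obtain ⟨k, hk⟩ := exists_exact_iterate_norm_sub_lt hTCC hζ0 hq0 hq1 hD hγ hγγ1 hγ0 hν0 hν1 hτ0
        hcq hC hhs hpB hDp huniq Metric.isClosed_closedBall hGc hxB (fun _ => rfl) hμx hne hε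
      exact ⟨k, fun i _ => hne i, hk⟩
  rw [Metric.tendsto_nhds]
  intro ε hε
  obtain ⟨k, hne, hk⟩ := hsmall ε hε
  obtain ⟨hkdp, hlim⟩ := hconv k hne
  filter_upwards [hkdp, (hlim.sub_const u0dag).norm.eventually_lt_const hk] with l hl hlt
  rw [dist_zero_right, norm_norm]
  exact (hle l k hl).trans_lt hlt
end
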